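/- Let ω > 0 be a real number and let η : ℝ² → ℂ be an integrable function that vanishes outside the closed unit disk centered at the origin. For t ∈ ℝ write û(t) = (cos t, sin t) ∈ ℝ², and define the linearized far-field data d₁(s, r) = ∫_{ℝ²} exp(−i ω (û(r) − û(s)) · x) η(x) dx for s, r ∈ ℝ. Define κ(h, ρ, y) = ρ · exp(2 i ρ ω · sin h · sin y). Then for all m, h ∈ ℝ, d₁(m − h, m + h) = ∫_{ρ=0}^{1} ∫_{θ=0}^{2π} κ(h, ρ, m − θ) · η(ρ cos θ, ρ sin θ) dθ dρ; moreover κ is 2π-periodic in its last argument, i.e. κ(h, ρ, y + 2π) = κ(h, ρ, y) for all h, ρ, y. (This is Proposition 2.1: the linearized forward map of the far field pattern problem acts on the scatterer by a convolution in the angular direction.) -/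

import Mathlib

open MeasureTheory Real Complex

/-- Proposition 2.1: the linearized far-field forward map acts on the scatterer by a
convolution in the angular direction. -/
theorem farfield_convolution
    (ω : ℝ) (hω : 0 < ω) (η : ℝ × ℝ → ℂ)
    (hη : MeasureTheory.Integrable η)
    (hsupp : ∀ x : ℝ × ℝ, 1 < x.1 ^ 2 + x.2 ^ 2 → η x = 0)
    (d₁ : ℝ → ℝ → ℂ)
    (hd₁ : ∀ s r : ℝ, d₁ s r =
      ∫ x : ℝ × ℝ, Complex.exp (-Complex.I * (ω : ℂ) *
        (((Real.cos r - Real.cos s) * x.1 + (Real.sin r - Real.sin s) * x.2 : ℝ) : ℂ)) * η x)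
    (κ : ℝ → ℝ → ℝ → ℂ)
    (hκ : ∀ h ρ y : ℝ, κ h ρ y =
      (ρ : ℂ) * Complex.exp (2 * Complex.I * (ρ : ℂ) * (ω : ℂ) *
        ((Real.sin h : ℝ) : ℂ) * ((Real.sin y : ℝ) : ℂ))) :
    (∀ m h : ℝ, d₁ (m - h) (m + h) =
      ∫ ρ in (0:ℝ)..1, ∫ θ in (0:ℝ)..(2 * Real.pi),
        κ h ρ (m - θ) * η (ρ * Real.cos θ, ρ * Real.sin θ)) ∧
    (∀ h ρ y : ℝ, κ h ρ (y + 2 * Real.pi) = κ h ρ y) := by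
  refine ⟨fun m h => ?_, fun h ρ y => by rw [hκ, hκ, Real.sin_add_two_pi]⟩
  rw [hd₁]
  set f : ℝ × ℝ → ℂ := fun x => Complex.exp (-Complex.I * (ω : ℂ) *
        (((Real.cos (m + h) - Real.cos (m - h)) * x.1
          + (Real.sin (m + h) - Real.sin (m - h)) * x.2 : ℝ) : ℂ)) * η x with hf
  have hfint : Integrable f := by
    refine hη.bdd_mul (c := 1) (Continuous.aestronglyMeasurable (by fun_prop)) ?_
    refine Filter.Eventually.of_forall fun x => ?_
    rw [Complex.norm_exp]
    simp only [Complex.mul_re, Complex.mul_im, Complex.neg_re, Complex.neg_im, Complex.I_re,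
      Complex.I_im, Complex.ofReal_re, Complex.ofReal_im]
    simp only [neg_zero, zero_mul, mul_zero, sub_zero, add_zero, Real.exp_zero, le_refl]
  have hpol : ∀ ρ θ : ℝ, ρ • f (ρ * Real.cos θ, ρ * Real.sin θ)
      = κ h ρ (m - θ) * η (ρ * Real.cos θ, ρ * Real.sin θ) := by
    intro ρ θ
    rw [hκ, hf, Complex.real_smul, mul_assoc]
    simp only
    congr 3
    have : (Real.cos (m + h) - Real.cos (m - h)) * (ρ * Real.cos θ)
          + (Real.sin (m + h) - Real.sin (m - h)) * (ρ * Real.sin θ)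
        = -2 * ρ * Real.sin h * Real.sin (m - θ) := by
      rw [Real.cos_add, Real.cos_sub, Real.sin_add, Real.sin_sub, Real.sin_sub]
      ring
    rw [this]
    push_cast
    ring
  have hint : IntegrableOn (fun p : ℝ × ℝ => p.1 • f (polarCoord.symm p))
      (Set.Ioi (0 : ℝ) ×ˢ Set.Ioo (-π) π) := by
    have h1 := (integrableOn_image_iff_integrableOn_abs_det_fderiv_smul volume
      polarCoord.open_target.measurableSet
      (fun p _ => (hasFDerivAt_polarCoord_symm p).hasFDerivWithinAt)
      polarCoord.symm.injOn f).1 hfint.integrableOn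
    refine h1.congr_fun ?_ polarCoord.open_target.measurableSet
    intro p hp
    have hp0 : 0 < p.1 := hp.1
    simp only [det_fderivPolarCoordSymm, abs_of_pos hp0]
  have hinner : ∀ ρ : ℝ, ∫ θ in Set.Ioo (-π) π, ρ • f (polarCoord.symm (ρ, θ))
      = ∫ θ in (0:ℝ)..(2 * Real.pi),
        κ h ρ (m - θ) * η (ρ * Real.cos θ, ρ * Real.sin θ) := by
    intro ρ
    have hper : Function.Periodic
        (fun θ => κ h ρ (m - θ) * η (ρ * Real.cos θ, ρ * Real.sin θ)) (2 * π) := by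
      intro θ
      simp only [hκ]
      rw [Real.cos_add_two_pi, Real.sin_add_two_pi, ← sub_sub, Real.sin_sub_two_pi]
    have h2 := hper.intervalIntegral_add_eq (-π) 0
    rw [zero_add, show -π + 2 * π = π by ring] at h2
    rw [← h2, intervalIntegral.integral_of_le (by linarith [Real.pi_pos]),
      integral_Ioc_eq_integral_Ioo]
    refine integral_congr_ae (Filter.Eventually.of_forall fun θ => ?_)
    exact hpol ρ θ
  rw [← integral_comp_polarCoord_symm f, polarCoord_target, Measure.volume_eq_prod,
    setIntegral_prod _ hint]
  simp only [hinner]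
  rw [intervalIntegral.integral_of_le zero_le_one]
  refine setIntegral_eq_of_subset_of_forall_sdiff_eq_zero measurableSet_Ioi
    (fun x hx => hx.1) ?_
  intro ρ hρ
  have h0 : 0 < ρ := hρ.1
  have h1 : 1 < ρ := by
    by_contra hc
    exact hρ.2 ⟨h0, not_lt.1 hc⟩
  have hz : ∀ θ : ℝ, η (ρ * Real.cos θ, ρ * Real.sin θ) = 0 := by
    intro θ
    apply hsupp
    have : (ρ * Real.cos θ) ^ 2 + (ρ * Real.sin θ) ^ 2 = ρ ^ 2 := by
      linear_combination ρ ^ 2 * Real.sin_sq_add_cos_sq θ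
    simp only [this]
    nlinarith
  simp [hz]
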